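/- arXiv:2511.02641 — 2 statements merged into one kernel-verified Lean document; each statement's English description precedes it below -/
import Mathlib

section
/- Let C be a cut of Q of type γ with B-periodic preimage Ĉ among the arrows of Q̂, fix 0 ≤ i ≤ d, and let o_i be the order of α_i + B in the finite group L/B. Then for every x ∈ L, m · #{ j ∈ {1,…,o_i} : the type-i arrow from x + (j−1)α_i to x + jα_i belongs to Ĉ } = o_i · γ_i; in particular this number of arrows is independent of x, and m divides o_iγ_i. -/
open scoped Classical

noncomputable section

namespace Paper

/-- The ambient lattice `ℤ^(d+1)`. -/
abbrev V (d : ℕ) : Type := Fin (d + 1) → ℤ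

/-- The coordinate-sum homomorphism. -/
def sumHom (d : ℕ) : V d →+ ℤ :=
  AddMonoidHom.mk' (fun v => ∑ i, v i) (fun a b => by
    simp [Finset.sum_add_distrib])

/-- The lattice `L` of integer vectors with coordinate sum zero. -/
def L (d : ℕ) : AddSubgroup (V d) := (sumHom d).ker

/-- `α i = e_i - e_{i-1}` (indices cyclic mod `d+1`), as an element of `L`. -/
def alpha (d : ℕ) (i : Fin (d + 1)) : L d :=
  ⟨Pi.single i 1 - Pi.single (i - 1) 1, by
    have : sumHom d (Pi.single i 1 - Pi.single (i - 1) 1) = 0 := by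
      simp [sumHom, Finset.sum_sub_distrib, Pi.single_apply]
    exact this⟩

/-- Arrows of the infinite quiver `Q̂`: the pair (source, type); the arrow of type `i`
with source `x` goes from `x` to `x + α i`. -/
abbrev ArrowHat (d : ℕ) : Type := L d × Fin (d + 1)

/-- Arrows of the quiver `Q` on `L/B`: the pair (source, type). -/
abbrev Arrow (d : ℕ) (B : AddSubgroup (L d)) : Type := (L d ⧸ B) × Fin (d + 1)

/-- The preimage among arrows of `Q̂` of a set of arrows of `Q`. -/
def preim (d : ℕ) (B : AddSubgroup (L d)) (C : Set (Arrow d B)) : Set (ArrowHat d) :=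
  {a | ((QuotientAddGroup.mk a.1 : L d ⧸ B), a.2) ∈ C}

/-- A set of arrows of `Q̂` is a cut if it contains exactly one arrow of every elementary
cycle.  Elementary cycles are exactly the cyclic paths of length `d+1` with pairwise distinct
types; they are parametrized by a starting vertex `x` and a permutation `σ` of the types,
the `k`-th arrow being the type-`σ k` arrow with source `x + ∑_{j<k} α (σ j)`. -/
def IsCutHat (d : ℕ) (Ch : Set (ArrowHat d)) : Prop :=
  ∀ (x : L d) (σ : Equiv.Perm (Fin (d + 1))),
    ∃! k : Fin (d + 1), (x + ∑ j ∈ Finset.Iio k, alpha d (σ j), σ k) ∈ Ch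

/-- A set of arrows of `Q̂` is `B`-periodic if it is invariant under translation by `B`. -/
def IsBPeriodic (d : ℕ) (B : AddSubgroup (L d)) (Ch : Set (ArrowHat d)) : Prop :=
  ∀ (a : ArrowHat d) (b : L d), b ∈ B → ((a.1 + b, a.2) ∈ Ch ↔ a ∈ Ch)

/-- A set of arrows of `Q` is a cut if its preimage among the arrows of `Q̂` is a cut. -/
def IsCut (d : ℕ) (B : AddSubgroup (L d)) (C : Set (Arrow d B)) : Prop :=
  IsCutHat d (preim d B C)

/-- The type of a cut of `Q`: the `i`-th entry is the number of arrows of type `i` in it. -/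
def cutType (d : ℕ) (B : AddSubgroup (L d)) (C : Set (Arrow d B)) : Fin (d + 1) → ℤ :=
  fun i => (Nat.card {v : L d ⧸ B // (v, i) ∈ C} : ℤ)

/-- A cut detector of type `γ`. -/
def IsCutDetector (d : ℕ) (B : AddSubgroup (L d)) (f : L d ⧸ B → ℤ)
    (γ : Fin (d + 1) → ℤ) : Prop :=
  f 0 = 0 ∧ ∀ (x : L d) (i : Fin (d + 1)),
    f (QuotientAddGroup.mk (x + alpha d i)) = f (QuotientAddGroup.mk x) + γ i ∨
    f (QuotientAddGroup.mk (x + alpha d i)) = f (QuotientAddGroup.mk x) + γ i - (B.index : ℤ)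

/-- The value `f_C` of an arrow of `Q̂`: `γ i - m` if the arrow lies in the given set of
arrows, and `γ i` otherwise (for an arrow of type `i`). -/
def arrowVal (d : ℕ) (Ch : Set (ArrowHat d)) (γ : Fin (d + 1) → ℤ) (m : ℤ)
    (a : ArrowHat d) : ℤ :=
  if a ∈ Ch then γ a.2 - m else γ a.2

/-- The value `f_C` of a path in `Q̂`, the path being recorded as its list of types together
with its source: the sum of the values of its arrows. -/
def pathVal (d : ℕ) (Ch : Set (ArrowHat d)) (γ : Fin (d + 1) → ℤ) (m : ℤ) :
    List (Fin (d + 1)) → L d → ℤ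
  | [], _ => 0
  | i :: p, x => arrowVal d Ch γ m (x, i) + pathVal d Ch γ m p (x + alpha d i)

/-- `f` is the function `f̄_C` induced by `f_C` on `L/B`:  for every `x ∈ L` and every path
`p` in `Q̂` from `0` to `x`, `f(x + B)` is the value of `p`. -/
def Detects (d : ℕ) (B : AddSubgroup (L d)) (C : Set (Arrow d B)) (γ : Fin (d + 1) → ℤ)
    (f : L d ⧸ B → ℤ) : Prop :=
  ∀ (x : L d) (p : List (Fin (d + 1))), (p.map (alpha d)).sum = x →
    f (QuotientAddGroup.mk x) = pathVal d (preim d B C) γ (B.index : ℤ) p 0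

/-- The set of arrows `C_f` of `Q` associated to a function `f : L/B → ℤ` (of type `γ`):
the arrows `x + B → x + α i + B` with `f(x + α i + B) = f(x + B) + γ i - m`. -/
def cutOf (d : ℕ) (B : AddSubgroup (L d)) (f : L d ⧸ B → ℤ) (γ : Fin (d + 1) → ℤ) :
    Set (Arrow d B) :=
  {a | ∃ x : L d, QuotientAddGroup.mk x = a.1 ∧
      f (QuotientAddGroup.mk (x + alpha d a.2)) = f a.1 + γ a.2 - (B.index : ℤ)}


/-- A path in the quiver `Q_C = Q ∖ C`, recorded as its list of types plus its source:
all its arrows avoid `C`. -/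
def avoids (d : ℕ) (B : AddSubgroup (L d)) (C : Set (Arrow d B)) :
    List (Fin (d + 1)) → (L d ⧸ B) → Prop
  | [], _ => True
  | i :: p, v => (v, i) ∉ C ∧ avoids d B C p (v + QuotientAddGroup.mk (alpha d i))

/-- A cut `C` of `Q` is bounding if the quiver `Q_C` obtained by deleting the arrows of `C`
has no cyclic path of positive length. -/
def IsBounding (d : ℕ) (B : AddSubgroup (L d)) (C : Set (Arrow d B)) : Prop :=
  ¬ ∃ (v : L d ⧸ B) (p : List (Fin (d + 1))), p ≠ [] ∧ avoids d B C p v ∧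
      v + QuotientAddGroup.mk ((p.map (alpha d)).sum) = v

/-- The homomorphism `Φ : ℤ^(d+1) → ℤ ⊕ L/B` with `Φ(e_i) = (γ_i, α_i + B)`. -/
def Phi (d : ℕ) (B : AddSubgroup (L d)) (γ : Fin (d + 1) → ℤ) :
    V d →+ ℤ × (L d ⧸ B) :=
  AddMonoidHom.mk'
    (fun v => (∑ i, v i * γ i, QuotientAddGroup.mk (∑ i, v i • alpha d i)))
    (fun a b => by
      have h1 : ∑ i, (a + b) i * γ i = (∑ i, a i * γ i) + ∑ i, b i * γ i := by
        rw [← Finset.sum_add_distrib]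
        exact Finset.sum_congr rfl fun i _ => by simp [add_mul]
      have h2 : (∑ i, (a + b) i • alpha d i) =
          (∑ i, a i • alpha d i) + ∑ i, b i • alpha d i := by
        rw [← Finset.sum_add_distrib]
        exact Finset.sum_congr rfl fun i _ => by simp [add_smul]
      show (∑ i, (a + b) i * γ i, QuotientAddGroup.mk (∑ i, (a + b) i • alpha d i)) =
        ((∑ i, a i * γ i, QuotientAddGroup.mk (∑ i, a i • alpha d i)) : ℤ × (L d ⧸ B)) +
          (∑ i, b i * γ i, QuotientAddGroup.mk (∑ i, b i • alpha d i))
      rw [Prod.mk_add_mk, h1, h2, QuotientAddGroup.mk_add])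

/-- The group `G(B,γ)`, the image of `Φ`. -/
abbrev GB (d : ℕ) (B : AddSubgroup (L d)) (γ : Fin (d + 1) → ℤ) :
    AddSubgroup (ℤ × (L d ⧸ B)) :=
  (Phi d B γ).range

/-- The element `x_i = Φ(e_i)` of `G(B,γ)`. -/
def xE (d : ℕ) (B : AddSubgroup (L d)) (γ : Fin (d + 1) → ℤ) (i : Fin (d + 1)) :
    GB d B γ :=
  ⟨Phi d B γ (Pi.single i 1), ⟨Pi.single i 1, rfl⟩⟩

/-- The element `p = ∑ x_i` of `G(B,γ)`. -/
def pE (d : ℕ) (B : AddSubgroup (L d)) (γ : Fin (d + 1) → ℤ) : GB d B γ :=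
  ∑ i, xE d B γ i

/-- Membership in `𝒥`: `J` contains exactly one element of every coset of `ℤp`, and for
`g ∈ J` and every `i`, `g + x_i ∈ J ∪ (J + p)`. -/
def InJ (d : ℕ) (B : AddSubgroup (L d)) (γ : Fin (d + 1) → ℤ)
    (J : Set (GB d B γ)) : Prop :=
  (∀ g : GB d B γ, ∃! n : ℤ, g + n • pE d B γ ∈ J) ∧
    ∀ g ∈ J, ∀ i : Fin (d + 1), g + xE d B γ i ∈ J ∨ g + xE d B γ i - pE d B γ ∈ J

/-- `f` is the function `f_J : L/B → ℤ` attached to `J ∈ 𝒥`:  whenever `n_J • p ∈ J`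
and `g ∈ J`, the value of `f` at the image of `g` under the second projection is
`π₁(g) - n_J · m`. -/
def IsFJ (d : ℕ) (B : AddSubgroup (L d)) (γ : Fin (d + 1) → ℤ)
    (J : Set (GB d B γ)) (f : L d ⧸ B → ℤ) : Prop :=
  ∀ n : ℤ, n • pE d B γ ∈ J → ∀ g ∈ J,
    f (g : ℤ × (L d ⧸ B)).2 = (g : ℤ × (L d ⧸ B)).1 - n * (B.index : ℤ)

/-- The cone of nonnegative integer combinations of the `x i`. -/
def cone {G : Type*} [AddCommGroup G] {n : ℕ} (x : Fin n → G) : Set G :=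
  {g | ∃ c : Fin n → ℕ, g = ∑ i, (c i : ℤ) • x i}

/-- Upper sets for the partial order `g ≤ h ↔ h - g ∈ cone x`. -/
def IsUpper {G : Type*} [AddCommGroup G] {n : ℕ} (x : Fin n → G) (I : Set G) : Prop :=
  ∀ g ∈ I, ∀ h : G, h - g ∈ cone x → h ∈ I

/-- `J(I) = I ∩ (Iᶜ + p)`. -/
def JofI {G : Type*} [AddCommGroup G] (p : G) (I : Set G) : Set G :=
  {g | g ∈ I ∧ g - p ∉ I}

/-- The set `𝒥̃` of subsets `J` with `g ≱ h + p` for all `g, h ∈ J` (where `p = ∑ x i`). -/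
def tilJSet {G : Type*} [AddCommGroup G] {n : ℕ} (x : Fin n → G) : Set (Set G) :=
  {J | ∀ g ∈ J, ∀ h ∈ J, g - (h + ∑ i, x i) ∉ cone x}

/-- The homomorphism `ℤ^(d+1) → G` sending `e_i` to `x i`. -/
def PhiG {G : Type*} [AddCommGroup G] (d : ℕ) (x : Fin (d + 1) → G) : V d →+ G :=
  AddMonoidHom.mk' (fun v => ∑ i, v i • x i) (fun a b => by
    rw [← Finset.sum_add_distrib]
    exact Finset.sum_congr rfl fun i _ => by simp [add_smul])

/-- A finitely generated abelian group of rank one with elements `x_0, …, x_d`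
satisfying (G1), (G2), (G3).  (Rank one is expressed by the existence of a surjective
homomorphism to `ℤ` whose kernel is exactly the torsion.) -/
def GoodPair (d : ℕ) (G : Type*) [AddCommGroup G] (x : Fin (d + 1) → G) : Prop :=
  AddGroup.FG G ∧
  (∃ π' : G →+ ℤ, Function.Surjective π' ∧ ∀ g : G, π' g = 0 ↔ IsOfFinAddOrder g) ∧
  (∀ i, x i ≠ 0) ∧
  (∀ g : G, ∃ c : Fin (d + 1) → ℤ, g = ∑ i, c i • x i) ∧
  (∀ g : G, g ∈ cone x → -g ∈ cone x → g = 0)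

/-- A pair `(B, γ)` of a finite-index subgroup `B ⊆ L` and a positive integer vector `γ`
satisfying the two conditions of Theorem `chartype`. -/
def GoodBgamma (d : ℕ) (B : AddSubgroup (L d)) (γ : Fin (d + 1) → ℤ) : Prop :=
  B.FiniteIndex ∧ (∀ i, 0 < γ i) ∧ (∑ i, γ i) = (B.index : ℤ) ∧
    ∀ m' : Fin (d + 1) → ℤ, (∑ i, m' i • alpha d i) ∈ B →
      (B.index : ℤ) ∣ ∑ i, m' i * γ i

/-- Indicator function of a set of arrows of `Q`. -/
def chi (d : ℕ) (B : AddSubgroup (L d)) (C : Set (Arrow d B)) (v : L d ⧸ B)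
    (i : Fin (d + 1)) : ℤ := if (v, i) ∈ C then 1 else 0

/-- The image of `α i` in `L/B`. -/
def abar (d : ℕ) (B : AddSubgroup (L d)) (i : Fin (d + 1)) : L d ⧸ B :=
  QuotientAddGroup.mk (alpha d i)

lemma sum_cycle (d : ℕ) (B : AddSubgroup (L d)) (C : Set (Arrow d B)) (hC : IsCut d B C)
    (v : L d ⧸ B) (σ : Equiv.Perm (Fin (d + 1))) :
    ∑ k, chi d B C (v + ∑ j ∈ Finset.Iio k, abar d B (σ j)) (σ k) = 1 := by
  obtain ⟨x, rfl⟩ := QuotientAddGroup.mk_surjective v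
  obtain ⟨k, hk, hu⟩ := hC x σ
  have key : ∀ k, ((QuotientAddGroup.mk x : L d ⧸ B) + ∑ j ∈ Finset.Iio k, abar d B (σ j))
      = QuotientAddGroup.mk (x + ∑ j ∈ Finset.Iio k, alpha d (σ j)) := by
    intro k
    have := map_sum (QuotientAddGroup.mk' B) (fun j => alpha d (σ j)) (Finset.Iio k)
    simp only [QuotientAddGroup.mk'_apply] at this
    rw [QuotientAddGroup.mk_add, this]
    rfl
  simp only [key]
  rw [Finset.sum_eq_single k]
  · exact if_pos hk
  · intro b _ hb
    exact if_neg fun h => hb (hu b h)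
  · simp

lemma chi_comm (d : ℕ) (hd : 1 ≤ d) (B : AddSubgroup (L d)) (C : Set (Arrow d B))
    (hC : IsCut d B C) (v : L d ⧸ B) (i k : Fin (d + 1)) (hik : i ≠ k) :
    chi d B C v i + chi d B C (v + abar d B i) k =
      chi d B C v k + chi d B C (v + abar d B k) i := by
  obtain ⟨e, rfl⟩ : ∃ e, d = e + 1 := ⟨d - 1, by omega⟩
  obtain ⟨σ, h0, h1⟩ : ∃ σ : Equiv.Perm (Fin (e + 1 + 1)), σ 0 = i ∧ σ 1 = k := by
    refine ⟨Equiv.swap 0 i * Equiv.swap 1 (Equiv.swap 0 i k), ?_, ?_⟩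
    · have hne : (0 : Fin (e + 1 + 1)) ≠ Equiv.swap 0 i k := by
        intro h
        apply hik
        have := congrArg (Equiv.swap 0 i) h
        simpa using this
      rw [Equiv.Perm.mul_apply, Equiv.swap_apply_of_ne_of_ne (by simp) hne]
      simp
    · simp
  have A := sum_cycle _ B C hC v σ
  have A' := sum_cycle _ B C hC v (σ * Equiv.swap 0 1)
  rw [Fin.sum_univ_succ, Fin.sum_univ_succ] at A A'
  have hI0 : Finset.Iio (0 : Fin (e + 1 + 1)) = ∅ := by
    ext a; simp
  have hI1 : Finset.Iio (1 : Fin (e + 1 + 1)) = {0} := by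
    ext a; rw [Finset.mem_Iio, Finset.mem_singleton, Fin.lt_def, Fin.ext_iff]; simp
  have hrest : ∀ t : Fin e,
      chi _ B C (v + ∑ j ∈ Finset.Iio t.succ.succ, abar _ B ((σ * Equiv.swap 0 1 : Equiv.Perm (Fin (e + 1 + 1))) j))
        ((σ * Equiv.swap 0 1 : Equiv.Perm (Fin (e + 1 + 1))) t.succ.succ) =
      chi _ B C (v + ∑ j ∈ Finset.Iio t.succ.succ, abar _ B (σ j)) (σ t.succ.succ) := by
    intro t
    have e1 : Equiv.swap (0 : Fin (e + 1 + 1)) 1 t.succ.succ = t.succ.succ :=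
      Equiv.swap_apply_of_ne_of_ne (by simp [Fin.ext_iff]) (by simp [Fin.ext_iff])
    have e2 := Equiv.Perm.sum_comp (Equiv.swap (0 : Fin (e + 1 + 1)) 1)
      (Finset.Iio t.succ.succ) (fun j => abar _ B (σ j)) (by
        intro a ha
        have : a = 0 ∨ a = 1 := by
          by_contra! h
          exact ha (Equiv.swap_apply_of_ne_of_ne h.1 h.2)
        rcases this with rfl | rfl <;> rw [Finset.mem_coe, Finset.mem_Iio, Fin.lt_def] <;> simp)
    simp only [Equiv.Perm.mul_apply, e1, e2]
  simp only [hrest] at A'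
  simp only [Fin.succ_zero_eq_one, hI0, hI1, Finset.sum_empty, Finset.sum_singleton,
    Equiv.Perm.mul_apply, Equiv.swap_apply_left, Equiv.swap_apply_right, h0, h1, add_zero] at A A'
  linarith

/-- Number of arrows of type `i` in `C` on the `α i`-cycle through `v`. -/
def cnt (d : ℕ) (B : AddSubgroup (L d)) (C : Set (Arrow d B)) (i : Fin (d + 1))
    (v : L d ⧸ B) : ℤ :=
  ∑ j ∈ Finset.range (addOrderOf (abar d B i)), chi d B C (v + j • abar d B i) i

lemma cnt_step (d : ℕ) (hd : 1 ≤ d) (B : AddSubgroup (L d)) (C : Set (Arrow d B))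
    (hC : IsCut d B C) (i k : Fin (d + 1)) (v : L d ⧸ B) :
    cnt d B C i (v + abar d B k) = cnt d B C i v := by
  have tele := Finset.sum_range_sub (fun j => chi d B C (v + j • abar d B i) k)
    (addOrderOf (abar d B i))
  simp only [addOrderOf_nsmul_eq_zero, zero_nsmul, sub_self] at tele
  rw [← sub_eq_zero, cnt, cnt, ← Finset.sum_sub_distrib, ← tele]
  refine Finset.sum_congr rfl fun j _ => ?_
  have e1 : v + (j + 1) • abar d B i = v + j • abar d B i + abar d B i := by
    rw [succ_nsmul, add_assoc]
  have e2 : v + abar d B k + j • abar d B i = v + j • abar d B i + abar d B k := by abel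
  rw [e1, e2]
  by_cases h : i = k
  · subst h; rfl
  · have := chi_comm d hd B C hC (v + j • abar d B i) i k h
    linarith

lemma mem_of_alpha (d : ℕ) (S : AddSubgroup (L d)) (hS : ∀ k, alpha d k ∈ S) (y : L d) :
    y ∈ S := by
  have hb : ∀ j : Fin (d + 1), ∃ z ∈ S, (z : V d) = Pi.single j 1 - Pi.single 0 1 := by
    intro j
    induction j using Fin.induction with
    | zero => exact ⟨0, S.zero_mem, by simp⟩
    | succ j ih =>
      obtain ⟨z, hz, e⟩ := ih
      refine ⟨alpha d j.succ + z, S.add_mem (hS _) hz, ?_⟩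
      have : j.succ - 1 = j.castSucc := by
        rw [sub_eq_iff_eq_add, Fin.coeSucc_eq_succ]
      simp [alpha, e, this]
  choose z hz e using hb
  have hy : y = ∑ j, (y : V d) j • z j := by
    apply Subtype.ext
    have h0 : ∑ j, (y : V d) j = 0 := y.2
    rw [AddSubgroup.val_finsetSum]
    simp only [AddSubgroup.coe_zsmul, e, smul_sub, Finset.sum_sub_distrib]
    rw [← Finset.sum_smul, h0, zero_smul, sub_zero]
    funext t
    simp [Finset.sum_apply, Pi.single_apply]
  rw [hy]
  exact S.sum_mem fun j _ => S.zsmul_mem (hz j) _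

lemma cnt_const (d : ℕ) (hd : 1 ≤ d) (B : AddSubgroup (L d)) (C : Set (Arrow d B))
    (hC : IsCut d B C) (i : Fin (d + 1)) (v w : L d ⧸ B) :
    cnt d B C i v = cnt d B C i w := by
  let S : AddSubgroup (L d) :=
    { carrier := {y | ∀ u, cnt d B C i (u + QuotientAddGroup.mk y) = cnt d B C i u}
      zero_mem' := by intro u; simp
      add_mem' := by
        intro a b ha hb u
        rw [QuotientAddGroup.mk_add, ← add_assoc, hb, ha]
      neg_mem' := by
        intro a ha u
        have := ha (u + QuotientAddGroup.mk (-a))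
        rw [← this, add_assoc, ← QuotientAddGroup.mk_add]
        simp }
  have key : ∀ y, y ∈ S := mem_of_alpha d S fun k u => cnt_step d hd B C hC i k u
  obtain ⟨y, hy⟩ := QuotientAddGroup.mk_surjective (v - w)
  have := key y w
  rw [hy, add_sub_cancel] at this
  exact this

theorem count_type_i_on_alpha_cycle (d : ℕ) (hd : 1 ≤ d) (B : AddSubgroup (L d))
    [B.FiniteIndex] (C : Set (Arrow d B)) (hC : IsCut d B C) (i : Fin (d + 1)) :
    (∀ x : L d,
      (B.index : ℤ) *
        (Nat.card {j : Fin (addOrderOf (QuotientAddGroup.mk (alpha d i) : L d ⧸ B)) //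
            (x + (j : ℕ) • alpha d i, i) ∈ preim d B C} : ℤ) =
      (addOrderOf (QuotientAddGroup.mk (alpha d i) : L d ⧸ B) : ℤ) * cutType d B C i) ∧
    (B.index : ℤ) ∣
      (addOrderOf (QuotientAddGroup.mk (alpha d i) : L d ⧸ B) : ℤ) * cutType d B C i := by
  have main : ∀ x : L d,
      (B.index : ℤ) *
        (Nat.card {j : Fin (addOrderOf (QuotientAddGroup.mk (alpha d i) : L d ⧸ B)) //
            (x + (j : ℕ) • alpha d i, i) ∈ preim d B C} : ℤ) =
      (addOrderOf (QuotientAddGroup.mk (alpha d i) : L d ⧸ B) : ℤ) * cutType d B C i := by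
    intro x
    have : Fintype (L d ⧸ B) := Fintype.ofFinite _
    have h1 : (Nat.card {j : Fin (addOrderOf (QuotientAddGroup.mk (alpha d i) : L d ⧸ B)) //
            (x + (j : ℕ) • alpha d i, i) ∈ preim d B C} : ℤ)
        = cnt d B C i (QuotientAddGroup.mk x) := by
      rw [Nat.card_eq_fintype_card, Fintype.card_subtype, Finset.card_filter, cnt,
        Finset.sum_range]
      push_cast
      rfl
    have h2 : cutType d B C i = ∑ v, chi d B C v i := by
      simp only [cutType, chi]
      rw [Nat.card_eq_fintype_card, Fintype.card_subtype, Finset.card_filter]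
      push_cast
      rfl
    have h3 : ∑ v, cnt d B C i v = (addOrderOf (abar d B i) : ℤ) * ∑ v, chi d B C v i := by
      simp only [cnt]
      rw [Finset.sum_comm]
      have : ∀ j ∈ Finset.range (addOrderOf (abar d B i)),
          ∑ v, chi d B C (v + j • abar d B i) i = ∑ v, chi d B C v i := fun j _ =>
        Equiv.sum_comp (Equiv.addRight (j • abar d B i)) (fun v => chi d B C v i)
      rw [Finset.sum_congr rfl this]
      simp
    have h4 : ∑ v, cnt d B C i v = (B.index : ℤ) * cnt d B C i (QuotientAddGroup.mk x) := by
      rw [Finset.sum_congr rfl fun v _ => cnt_const d hd B C hC i v (QuotientAddGroup.mk x)]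
      simp [AddSubgroup.index, Nat.card_eq_fintype_card]
    rw [h1, h2, ← h4, h3]
    rfl
  exact ⟨main, ⟨_, (main 0).symm⟩⟩


end Paper
end
end

section
/- The group homomorphism φ : G(B,γ)/ℤp → L/B induced by restricting the second projection ℤ ⊕ L/B → L/B to G(B,γ) is an isomorphism of abelian groups. -/
open scoped Classical

noncomputable section

namespace Paper

theorem sum_alpha_apply (d : ℕ) (c : Fin (d + 1) → ℤ) (j : Fin (d + 1)) :
    ((∑ i, c i • alpha d i : L d) : V d) j = c j - c (j + 1) := by
  have h : ((∑ i, c i • alpha d i : L d) : V d)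
      = ∑ i, c i • (Pi.single i 1 - Pi.single (i - 1) 1 : V d) := by
    rw [AddSubgroup.val_finset_sum]
    rfl
  rw [h, Finset.sum_apply]
  have h2 : ∀ i, (c i • (Pi.single i 1 - Pi.single (i - 1) 1 : V d)) j
      = (if j = i then c i else 0) - (if j + 1 = i then c i else 0) := by
    intro i
    have : (j = i - 1) ↔ (j + 1 = i) := eq_sub_iff_add_eq
    simp [Pi.single_apply, mul_sub, this]
  simp [h2, Finset.sum_sub_distrib]

theorem sum_alpha_eq_zero (d : ℕ) : ∑ i, (1 : ℤ) • alpha d i = 0 := by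
  apply Subtype.ext
  funext j
  have := sum_alpha_apply d (fun _ => 1) j
  simpa using this

theorem alpha_span (d : ℕ) (v : L d) : ∃ c : Fin (d + 1) → ℤ, ∑ i, c i • alpha d i = v := by
  have hv : ∑ i, (v : V d) i = 0 := v.2
  refine ⟨fun j => - ∑ k ∈ Finset.univ.filter (fun k => k < j), (v : V d) k, ?_⟩
  apply Subtype.ext
  funext j
  rw [sum_alpha_apply]
  induction j using Fin.lastCases with
  | last =>
    have h0 : (Fin.last d + 1 : Fin (d + 1)) = 0 := by simp
    rw [h0]
    have h1 : Finset.univ.filter (fun k : Fin (d + 1) => k < Fin.last d)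
        = Finset.univ.erase (Fin.last d) := by
      ext k
      simp [Fin.lt_last_iff_ne_last]
    rw [h1]
    have := Finset.add_sum_erase Finset.univ (v : V d) (Finset.mem_univ (Fin.last d))
    simp
    linarith
  | cast j =>
    have h0 : (j.castSucc + 1 : Fin (d + 1)) = j.succ := by simp
    rw [h0]
    have h1 : Finset.univ.filter (fun k : Fin (d + 1) => k < j.succ)
        = insert j.castSucc (Finset.univ.filter (fun k => k < j.castSucc)) := by
      ext k
      simp [Fin.lt_def, Fin.ext_iff]
      omega
    rw [h1, Finset.sum_insert (by simp)]
    ring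

theorem pE_val (d : ℕ) (B : AddSubgroup (L d)) (γ : Fin (d + 1) → ℤ) :
    (pE d B γ : ℤ × (L d ⧸ B)) = (∑ i, γ i, 0) := by
  have h : (pE d B γ : ℤ × (L d ⧸ B)) = Phi d B γ (fun _ => 1) := by
    rw [pE, AddSubgroup.val_finset_sum]
    change ∑ i, Phi d B γ (Pi.single i 1) = _
    rw [← map_sum]
    congr 1
    exact Finset.univ_sum_single (fun _ => (1 : ℤ))
  rw [h]
  change (∑ i, (1 : ℤ) * γ i, QuotientAddGroup.mk (∑ i, (1 : ℤ) • alpha d i)) = _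
  rw [sum_alpha_eq_zero]
  simp

theorem phi_quotient_iso (d : ℕ) (hd : 1 ≤ d) (B : AddSubgroup (L d)) [B.FiniteIndex]
    (γ : Fin (d + 1) → ℤ) (hγ : ∀ i, 0 ≤ γ i)
    (hsum : (∑ i, γ i) = (B.index : ℤ))
    (hadm : ∀ m' : Fin (d + 1) → ℤ, (∑ i, m' i • alpha d i) ∈ B →
      (B.index : ℤ) ∣ ∑ i, m' i * γ i) :
    ∃ e : (GB d B γ ⧸ AddSubgroup.zmultiples (pE d B γ)) ≃+ (L d ⧸ B),
      ∀ g : GB d B γ, e (QuotientAddGroup.mk g) = (g : ℤ × (L d ⧸ B)).2 := by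
  let ψ : GB d B γ →+ (L d ⧸ B) := (AddMonoidHom.snd ℤ (L d ⧸ B)).comp (GB d B γ).subtype
  have hsurj : Function.Surjective ψ := by
    intro q
    induction q using QuotientAddGroup.induction_on with
    | H v =>
      obtain ⟨c, hc⟩ := alpha_span d v
      refine ⟨⟨Phi d B γ c, c, rfl⟩, ?_⟩
      change QuotientAddGroup.mk (∑ i, c i • alpha d i) = _
      rw [hc]
  have hker : AddSubgroup.zmultiples (pE d B γ) = ψ.ker := by
    ext g
    rw [AddSubgroup.mem_zmultiples_iff, AddMonoidHom.mem_ker]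
    constructor
    · rintro ⟨n, rfl⟩
      rw [map_zsmul]
      change n • (pE d B γ : ℤ × (L d ⧸ B)).2 = 0
      rw [pE_val]
      simp
    · obtain ⟨_, c, rfl⟩ := g
      intro h
      change QuotientAddGroup.mk (∑ i, c i • alpha d i) = (0 : L d ⧸ B) at h
      obtain ⟨n, hn⟩ := hadm c ((QuotientAddGroup.eq_zero_iff _).1 h)
      refine ⟨n, Subtype.ext ?_⟩
      change n • (pE d B γ : ℤ × (L d ⧸ B))
        = (∑ i, c i * γ i, QuotientAddGroup.mk (∑ i, c i • alpha d i))
      rw [pE_val, h, hn, hsum]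
      simp [mul_comm]
  refine ⟨(QuotientAddGroup.quotientAddEquivOfEq hker).trans
    (QuotientAddGroup.quotientKerEquivOfSurjective ψ hsurj), fun g => rfl⟩
end Paper
end
end
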